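/- In the Hopf algebra ℚ[t_α] freely generated by isomorphism types of simple connected graphs (the natural Hopf algebra of the graph operad), the antipode of the generator corresponding to the graph K₄ − e (the complete graph on 4 vertices minus one edge) equals −t_{K₄−e} + 3·t_{P₃}·t_{K₂}, where P₃ is the path on 3 vertices and K₂ the single edge. -/

import Mathlib

open scoped Classical TensorProduct

noncomputable section

/-- Labelled simple graphs (on finite ordinal vertex sets). -/
abbrev GBase : Type := Σ n : ℕ, SimpleGraph (Fin n)

/-- Two labelled graphs are equivalent iff they are isomorphic. -/
def gSetoid : Setoid GBase :=
  ⟨fun a b => Nonempty (a.2 ≃g b.2), by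
    constructor
    · exact fun a => ⟨SimpleGraph.Iso.refl⟩
    · rintro a b ⟨e⟩; exact ⟨e.symm⟩
    · rintro a b c ⟨e⟩ ⟨e'⟩; exact ⟨e.trans e'⟩⟩

/-- Isomorphism types of labelled simple graphs. -/
def GType : Type := Quotient gSetoid

/-- The natural Hopf algebra of the graph operad, as a commutative algebra:
the polynomial ring on isomorphism types of graphs. -/
abbrev RG : Type := MvPolynomial GType ℚ

/-- The generator `t_{τ(g)}` associated to a graph `g`; the singleton type is
identified with `1`. -/
noncomputable def tt {W : Type} [Fintype W] (g : SimpleGraph W) : RG :=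
  if 2 ≤ Fintype.card W then
    MvPolynomial.X (Quotient.mk gSetoid
      ⟨Fintype.card W, SimpleGraph.map (Fintype.equivFin W).toEmbedding g⟩)
  else 1

/-- The operad product `η` of the operad of connected graphs:  the assembly is
encoded as a graph `h` (whose connected components are the members of the
assembly, the blocks of the partition being its connected components), and the
external graph `g'` lives on the components of `h`.  All edges of `h` are kept
and all vertices of adjacent (in `g'`) components get joined. -/
def etaG {V : Type} (h : SimpleGraph V) (g' : SimpleGraph h.ConnectedComponent) :
    SimpleGraph V :=
  SimpleGraph.fromRel fun u v =>
    h.Adj u v ∨ g'.Adj (h.connectedComponentMk u) (h.connectedComponentMk v)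

/-- `(h, g')` is a factorization of the connected graph `g` in the graph operad. -/
def IsGFactorization {n : ℕ} (g : SimpleGraph (Fin n))
    (x : Σ h : SimpleGraph (Fin n), SimpleGraph h.ConnectedComponent) : Prop :=
  x.2.Connected ∧ etaG x.1 x.2 = g

/-- The summand `t_{τ(a)} ⊗ t_{τ(g')}` of the coproduct, for a factorization
`(h, g')`:  `t_{τ(a)}` is the product of generators of the components of `h`. -/
noncomputable def gCoprodSummand {n : ℕ}
    (x : Σ h : SimpleGraph (Fin n), SimpleGraph h.ConnectedComponent) : RG ⊗[ℚ] RG :=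
  (∏ c : x.1.ConnectedComponent,
      tt (SimpleGraph.induce {v : Fin n | x.1.connectedComponentMk v = c} x.1))
    ⊗ₜ[ℚ] tt x.2

/-- The graph `K₄ − e` (complete graph on 4 vertices minus the edge `{2,3}`). -/
def K4e : SimpleGraph (Fin 4) :=
  SimpleGraph.fromRel fun i j => ¬((i = 2 ∧ j = 3) ∨ (i = 3 ∧ j = 2))

/-- The path on three vertices. -/
def P3 : SimpleGraph (Fin 3) :=
  SimpleGraph.fromRel fun i j => (i = 0 ∧ j = 1) ∨ (i = 1 ∧ j = 2)

/-- The single edge. -/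
def K2 : SimpleGraph (Fin 2) := ⊤


theorem tt_congr {W W' : Type} [Fintype W] [Fintype W'] {g : SimpleGraph W}
    {g' : SimpleGraph W'} (e : g ≃g g') : tt g = tt g' := by
  have hc : Fintype.card W = Fintype.card W' := Fintype.card_congr e.toEquiv
  unfold tt
  by_cases h : 2 ≤ Fintype.card W
  · rw [if_pos h, if_pos (hc ▸ h)]
    congr 1
    apply Quotient.sound
    exact ⟨((SimpleGraph.Iso.map (Fintype.equivFin W) g).symm.trans e).trans
      (SimpleGraph.Iso.map (Fintype.equivFin W') g')⟩
  · rw [if_neg h, if_neg (hc ▸ h)]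

theorem tt_one {W : Type} [Fintype W] (g : SimpleGraph W) (h : Fintype.card W < 2) :
    tt g = 1 := by
  unfold tt
  rw [if_neg (by omega)]

section aux

variable {n k : ℕ} {g : SimpleGraph (Fin n)}
  {x y : Σ h : SimpleGraph (Fin n), SimpleGraph h.ConnectedComponent}

theorem fact_adj_left (hx : IsGFactorization g x) (u v : Fin n) :
    x.1.Adj u v ↔ g.Adj u v ∧ x.1.Reachable u v := by
  obtain ⟨h, g'⟩ := x
  obtain ⟨-, rfl⟩ := hx
  simp only [etaG, SimpleGraph.fromRel_adj]
  constructor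
  · intro h1
    exact ⟨⟨h1.ne, Or.inl (Or.inl h1)⟩, h1.reachable⟩
  · rintro ⟨⟨hne, (h1 | h1) | (h1 | h1)⟩, hr⟩
    · exact h1
    · exact absurd (SimpleGraph.ConnectedComponent.eq.2 hr) h1.ne
    · exact h1.symm
    · exact absurd (SimpleGraph.ConnectedComponent.eq.2 hr).symm h1.ne

theorem fact_adj_right (hx : IsGFactorization g x) (u v : Fin n) :
    x.2.Adj (x.1.connectedComponentMk u) (x.1.connectedComponentMk v) ↔
      g.Adj u v ∧ ¬ x.1.Reachable u v := by
  obtain ⟨h, g'⟩ := x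
  obtain ⟨-, rfl⟩ := hx
  simp only [etaG, SimpleGraph.fromRel_adj]
  constructor
  · intro h1
    refine ⟨⟨?_, Or.inl (Or.inr h1)⟩, fun hr => ?_⟩
    · rintro rfl
      exact h1.ne rfl
    · exact h1.ne (SimpleGraph.ConnectedComponent.eq.2 hr)
  · rintro ⟨⟨hne, (h1 | h1) | (h1 | h1)⟩, hr⟩
    · exact absurd h1.reachable hr
    · exact h1
    · exact absurd h1.reachable.symm hr
    · exact h1.symm

theorem fact_uniq (hx : IsGFactorization g x) (hy : IsGFactorization g y)
    (hr : ∀ u v, x.1.Reachable u v ↔ y.1.Reachable u v) : x = y := by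
  have h1 : x.1 = y.1 := by
    ext u v
    rw [fact_adj_left hx, fact_adj_left hy, hr]
  have hx2 := fact_adj_right hx
  have hy2 := fact_adj_right hy
  obtain ⟨h, a⟩ := x
  obtain ⟨h', b⟩ := y
  dsimp only at h1
  subst h1
  congr 1
  ext c d
  induction c using SimpleGraph.ConnectedComponent.ind with | _ u
  induction d using SimpleGraph.ConnectedComponent.ind with | _ v
  exact (hx2 u v).trans (hy2 u v).symm

theorem fact_module (hx : IsGFactorization g x) (u v w : Fin n)
    (h1 : x.1.Reachable u v) (h2 : ¬ x.1.Reachable u w) (h3 : g.Adj u w) : g.Adj v w := by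
  have := (fact_adj_right hx u w).2 ⟨h3, h2⟩
  rw [SimpleGraph.ConnectedComponent.eq.2 h1] at this
  exact ((fact_adj_right hx v w).1 this).1

theorem fact_nbr (hx : IsGFactorization g x) (u v : Fin n)
    (h1 : x.1.Reachable u v) (h2 : u ≠ v) : ∃ w, g.Adj u w ∧ x.1.Reachable u w := by
  obtain ⟨p⟩ := h1
  cases p with
  | nil => exact absurd rfl h2
  | cons h p => exact ⟨_, (fact_adj_left hx _ _).1 h⟩

theorem fact_exists (hg : g.Connected) (f : Fin n → Fin k)
    (hc : ∀ u v, f u = f v → u = v ∨ g.Adj u v ∨ ∃ w, f w = f u ∧ g.Adj u w ∧ g.Adj w v)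
    (hm : ∀ u v w, f u = f v → f u ≠ f w → g.Adj u w → g.Adj v w) :
    ∃ x, IsGFactorization g x ∧ ∀ u v, x.1.Reachable u v ↔ f u = f v := by
  let h : SimpleGraph (Fin n) :=
    { Adj := fun u v => g.Adj u v ∧ f u = f v
      symm := ⟨fun u v hh => ⟨hh.1.symm, hh.2.symm⟩⟩
      loopless := ⟨fun u hh => hh.1.ne rfl⟩ }
  have hr : ∀ u v, h.Reachable u v ↔ f u = f v := by
    intro u v
    constructor
    · rintro ⟨p⟩
      induction p with
      | nil => rfl
      | cons a p ih => exact a.2.trans ih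
    · intro e
      rcases hc u v e with rfl | a | ⟨w, e', a, b⟩
      · exact SimpleGraph.Reachable.refl _
      · exact SimpleGraph.Adj.reachable (G := h) ⟨a, e⟩
      · exact (SimpleGraph.Adj.reachable (G := h) ⟨a, e'.symm⟩).trans
          (SimpleGraph.Adj.reachable (G := h) ⟨b, e'.trans e⟩)
  let g' : SimpleGraph h.ConnectedComponent :=
    { Adj := fun c d => c ≠ d ∧ ∃ u v, h.connectedComponentMk u = c ∧
        h.connectedComponentMk v = d ∧ g.Adj u v
      symm := ⟨by
        rintro c d ⟨hne, u, v, a, b, e⟩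
        exact ⟨hne.symm, v, u, b, a, e.symm⟩⟩
      loopless := ⟨fun u hh => hh.1 rfl⟩ }
  have hg' : ∀ u v, g'.Adj (h.connectedComponentMk u) (h.connectedComponentMk v) ↔
      f u ≠ f v ∧ g.Adj u v := by
    intro u v
    constructor
    · rintro ⟨hne, u', v', a, b, e⟩
      rw [SimpleGraph.ConnectedComponent.eq, hr] at a b
      rw [Ne, SimpleGraph.ConnectedComponent.eq, hr] at hne
      refine ⟨hne, ?_⟩
      have h1 := hm u' u v' a (by rwa [a, b]) e
      exact (hm v' v u b (by rw [b]; exact Ne.symm hne) h1.symm).symm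
    · rintro ⟨hne, a⟩
      refine ⟨?_, u, v, rfl, rfl, a⟩
      rwa [Ne, SimpleGraph.ConnectedComponent.eq, hr]
  refine ⟨⟨h, g'⟩, ⟨?_, ?_⟩, hr⟩
  · have : Nonempty h.ConnectedComponent := hg.nonempty.map h.connectedComponentMk
    refine SimpleGraph.Connected.mk ?_
    intro c d
    induction c using SimpleGraph.ConnectedComponent.ind with | _ u
    induction d using SimpleGraph.ConnectedComponent.ind with | _ v
    obtain ⟨p⟩ := hg.preconnected u v
    induction p with
    | nil => exact SimpleGraph.Reachable.refl _
    | @cons a b c e p ih =>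
      refine SimpleGraph.Reachable.trans ?_ ih
      by_cases hab : f a = f b
      · rw [SimpleGraph.ConnectedComponent.eq.2 ((hr a b).2 hab)]
      · exact SimpleGraph.Adj.reachable ((hg' a b).2 ⟨hab, e⟩)
  · ext u v
    simp only [etaG, SimpleGraph.fromRel_adj, hg']
    constructor
    · rintro ⟨hne, (h1 | h1) | (h1 | h1)⟩
      · exact h1.1
      · exact h1.2
      · exact h1.1.symm
      · exact h1.2.symm
    · intro e
      refine ⟨e.ne, Or.inl ?_⟩
      by_cases hab : f u = f v
      · exact Or.inl ⟨e, hab⟩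
      · exact Or.inr ⟨hab, e⟩

theorem fact_value (hx : IsGFactorization g x) (f : Fin n → Fin k)
    (hr : ∀ u v, x.1.Reachable u v ↔ f u = f v) (hf : Function.Surjective f)
    (Q : SimpleGraph (Fin k))
    (hQ : ∀ u v, Q.Adj (f u) (f v) ↔ f u ≠ f v ∧ g.Adj u v) (S : RG →ₐ[ℚ] RG) :
    S (∏ c : x.1.ConnectedComponent,
            tt (SimpleGraph.induce {v : Fin n | x.1.connectedComponentMk v = c} x.1))
          * tt x.2 = S (∏ i : Fin k, tt (SimpleGraph.induce {v : Fin n | f v = i} g)) * tt Q := by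
  let F : x.1.ConnectedComponent → Fin k :=
    Quot.lift f (fun u v h => (hr u v).1 h)
  have hF : ∀ u, F (x.1.connectedComponentMk u) = f u := fun u => rfl
  have hFb : Function.Bijective F := by
    constructor
    · intro c d
      induction c using SimpleGraph.ConnectedComponent.ind with | _ u
      induction d using SimpleGraph.ConnectedComponent.ind with | _ v
      intro h
      exact SimpleGraph.ConnectedComponent.eq.2 ((hr u v).2 h)
    · intro i
      obtain ⟨u, rfl⟩ := hf i
      exact ⟨x.1.connectedComponentMk u, hF u⟩
  let e := Equiv.ofBijective F hFb
  have h2 : tt x.2 = tt Q := by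
    refine tt_congr ⟨e, ?_⟩
    intro c d
    induction c using SimpleGraph.ConnectedComponent.ind with | _ u
    induction d using SimpleGraph.ConnectedComponent.ind with | _ v
    rw [fact_adj_right hx, hr]
    exact (hQ u v).trans and_comm
  have h1 : (∏ c : x.1.ConnectedComponent,
      tt (SimpleGraph.induce {v : Fin n | x.1.connectedComponentMk v = c} x.1)) =
      ∏ i : Fin k, tt (SimpleGraph.induce {v : Fin n | f v = i} g) := by
    refine Fintype.prod_equiv e _ _ ?_
    intro c
    have hs : ∀ v, v ∈ {v : Fin n | x.1.connectedComponentMk v = c} ↔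
        v ∈ {v : Fin n | f v = e c} := by
      intro v
      exact ⟨fun h => by rw [← (h : x.1.connectedComponentMk v = c)]; rfl,
        fun h => hFb.1 h⟩
    refine tt_congr ⟨Equiv.subtypeEquivRight hs, ?_⟩
    rintro ⟨a, ha⟩ ⟨b, hb⟩
    have hab : x.1.Reachable a b := SimpleGraph.ConnectedComponent.eq.1
      ((ha : x.1.connectedComponentMk a = c).trans (hb : x.1.connectedComponentMk b = c).symm)
    simp only [SimpleGraph.comap_adj, SimpleGraph.induce]
    exact ⟨fun h => (fact_adj_left hx a b).2 ⟨h, hab⟩, fun h => ((fact_adj_left hx a b).1 h).1⟩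
  rw [h1, h2]

theorem fact_bot (hg : g.Connected) (S : RG →ₐ[ℚ] RG) :
    ∃ x, IsGFactorization g x ∧ (∀ u v, x.1.Reachable u v ↔ u = v) ∧
    S (∏ c : x.1.ConnectedComponent,
            tt (SimpleGraph.induce {v : Fin n | x.1.connectedComponentMk v = c} x.1))
          * tt x.2 = tt g := by
  obtain ⟨x, hx, hr⟩ := fact_exists hg (id : Fin n → Fin n) (fun u v h => Or.inl h)
    (by rintro u v w h - hh; cases h; exact hh)
  refine ⟨x, hx, hr, ?_⟩
  rw [fact_value hx id hr Function.surjective_id g (fun u v => ⟨fun h => ⟨h.ne, h⟩, fun h => h.2⟩)]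
  rw [Finset.prod_eq_one, map_one, one_mul]
  intro i _
  apply tt_one
  have : Fintype.card {v : Fin n | id v = i} ≤ 1 := by
    rw [Fintype.card_le_one_iff]
    rintro ⟨a, ha⟩ ⟨b, hb⟩
    exact Subtype.ext ((ha : a = i).trans (hb : b = i).symm)
  omega

theorem fact_top (hg : g.Connected) (S : RG →ₐ[ℚ] RG)
    (hc : ∀ u v, u = v ∨ g.Adj u v ∨ ∃ w, g.Adj u w ∧ g.Adj w v) :
    ∃ x, IsGFactorization g x ∧ (∀ u v, x.1.Reachable u v) ∧
    S (∏ c : x.1.ConnectedComponent,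
            tt (SimpleGraph.induce {v : Fin n | x.1.connectedComponentMk v = c} x.1))
          * tt x.2 = S (tt g) := by
  obtain ⟨x, hx, hr⟩ := fact_exists hg (fun _ => 0 : Fin n → Fin 1)
    (fun u v _ => by simpa using hc u v) (fun u v w _ h => absurd rfl h)
  refine ⟨x, hx, fun u v => (hr u v).2 rfl, ?_⟩
  have := hg.nonempty
  rw [fact_value hx _ hr (fun i => ⟨Classical.arbitrary _, Subsingleton.elim _ _⟩) ⊥
    (fun u v => by simp)]
  rw [tt_one (⊥ : SimpleGraph (Fin 1)) (by simp), mul_one, Fin.prod_univ_one]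
  congr 1
  refine tt_congr ⟨Equiv.subtypeUnivEquiv (fun v => rfl), ?_⟩
  intro a b
  rfl

end aux

theorem K4e_adj (u v : Fin 4) : K4e.Adj u v ↔
    u ≠ v ∧ ¬((u = 2 ∧ v = 3) ∨ (u = 3 ∧ v = 2)) := by
  simp only [K4e, SimpleGraph.fromRel_adj]
  tauto

theorem P3_adj (u v : Fin 3) : P3.Adj u v ↔
    ((u = 0 ∧ v = 1) ∨ (u = 1 ∧ v = 2)) ∨ ((v = 0 ∧ u = 1) ∨ (v = 1 ∧ u = 2)) := by
  simp only [P3, SimpleGraph.fromRel_adj]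
  revert u v
  decide

theorem K2_adj (u v : Fin 2) : K2.Adj u v ↔ u ≠ v := by
  simp [K2]

theorem conn_of_diam {n : ℕ} {g : SimpleGraph (Fin n)} (hn : 0 < n)
    (hc : ∀ u v, u = v ∨ g.Adj u v ∨ ∃ w, g.Adj u w ∧ g.Adj w v) : g.Connected := by
  have : Nonempty (Fin n) := ⟨⟨0, hn⟩⟩
  refine SimpleGraph.Connected.mk ?_
  intro u v
  rcases hc u v with rfl | a | ⟨w, a, b⟩
  · exact SimpleGraph.Reachable.refl _
  · exact a.reachable
  · exact a.reachable.trans b.reachable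

theorem K4e_diam (u v : Fin 4) : u = v ∨ K4e.Adj u v ∨ ∃ w, K4e.Adj u w ∧ K4e.Adj w v := by
  simp only [K4e_adj]
  revert u v
  decide

theorem P3_diam (u v : Fin 3) : u = v ∨ P3.Adj u v ∨ ∃ w, P3.Adj u w ∧ P3.Adj w v := by
  simp only [P3_adj]
  revert u v
  decide

theorem K2_diam (u v : Fin 2) : u = v ∨ K2.Adj u v ∨ ∃ w, K2.Adj u w ∧ K2.Adj w v := by
  simp only [K2_adj]
  revert u v
  decide

theorem prim_of {n : ℕ} {g : SimpleGraph (Fin n)} (hn : 2 ≤ n) (S : RG →ₐ[ℚ] RG)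
    (hS : ∑ x ∈ Finset.univ.filter (IsGFactorization g),
        S (∏ c : x.1.ConnectedComponent,
            tt (SimpleGraph.induce {v : Fin n | x.1.connectedComponentMk v = c} x.1))
          * tt x.2 = 0)
    (hc : ∀ u v, u = v ∨ g.Adj u v ∨ ∃ w, g.Adj u w ∧ g.Adj w v)
    (hall : ∀ x, IsGFactorization g x →
      (∀ u v, x.1.Reachable u v ↔ u = v) ∨ ∀ u v, x.1.Reachable u v) :
    S (tt g) = - tt g := by
  have hg := conn_of_diam (by omega) hc
  obtain ⟨x, hx, hxr, hxv⟩ := fact_bot hg S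
  obtain ⟨y, hy, hyr, hyv⟩ := fact_top hg S hc
  have hne : x ≠ y := by
    rintro rfl
    have := (hxr ⟨0, by omega⟩ ⟨1, by omega⟩).1 (hyr _ _)
    simp at this
  have hfil : Finset.univ.filter (IsGFactorization g) = {x, y} := by
    ext z
    simp only [Finset.mem_filter, Finset.mem_univ, true_and, Finset.mem_insert,
      Finset.mem_singleton]
    constructor
    · intro hz
      rcases hall z hz with h | h
      · exact Or.inl (fact_uniq hz hx fun u v => (h u v).trans (hxr u v).symm)
      · exact Or.inr (fact_uniq hz hy fun u v => ⟨fun _ => hyr u v, fun _ => h u v⟩)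
    · rintro (rfl | rfl) <;> assumption
  rw [hfil, Finset.sum_pair hne, hxv, hyv] at hS
  exact (neg_eq_of_add_eq_zero_right hS).symm

theorem K2_prim (S : RG →ₐ[ℚ] RG)
    (hS : ∑ x ∈ Finset.univ.filter (IsGFactorization K2),
        S (∏ c : x.1.ConnectedComponent,
            tt (SimpleGraph.induce {v : Fin 2 | x.1.connectedComponentMk v = c} x.1))
          * tt x.2 = 0) : S (tt K2) = - tt K2 := by
  refine prim_of le_rfl S hS K2_diam ?_
  intro x hx
  have r := fun u => SimpleGraph.Reachable.refl (G := x.1) u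
  have s := fun u v => SimpleGraph.Reachable.symm (G := x.1) (u := u) (v := v)
  by_cases h : x.1.Reachable 0 1
  · right
    simp [Fin.forall_fin_two, h, h.symm]
  · left
    have h' : ¬ x.1.Reachable 1 0 := fun a => h a.symm
    simp [Fin.forall_fin_two, h, h']

theorem P3_prim (S : RG →ₐ[ℚ] RG)
    (hS : ∑ x ∈ Finset.univ.filter (IsGFactorization P3),
        S (∏ c : x.1.ConnectedComponent,
            tt (SimpleGraph.induce {v : Fin 3 | x.1.connectedComponentMk v = c} x.1))
          * tt x.2 = 0) : S (tt P3) = - tt P3 := by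
  refine prim_of (by norm_num) S hS P3_diam ?_
  intro x hx
  have s : ∀ u v, x.1.Reachable u v ↔ x.1.Reachable v u := fun u v => ⟨fun h => h.symm, fun h => h.symm⟩
  have m := fact_module hx
  have nb := fact_nbr hx
  have t := fun u v w => SimpleGraph.Reachable.trans (G := x.1) (u := u) (v := v) (w := w)
  simp only [P3_adj] at m nb
  have h01 : x.1.Reachable 0 1 → x.1.Reachable 0 2 := by
    intro h
    by_contra h2
    have := m 1 0 2 h.symm (fun h3 => h2 (h.trans h3)) (by decide)
    revert this; decide
  have h12 : x.1.Reachable 1 2 → x.1.Reachable 0 1 := by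
    intro h
    by_contra h2
    have := m 1 2 0 h (fun h3 => h2 h3.symm) (by decide)
    revert this; decide
  have h02 : x.1.Reachable 0 2 → x.1.Reachable 0 1 := by
    intro h
    obtain ⟨w, h1, h2⟩ := nb 0 2 h (by decide)
    have : w = 1 := by clear h2; revert h1; revert w; decide
    rwa [this] at h2
  by_cases h : x.1.Reachable 0 1
  · right
    have a := h01 h
    have b := h.symm.trans a
    simp [Fin.forall_fin_succ, h, h.symm, a, a.symm, b, b.symm]
  · left
    have a : ¬ x.1.Reachable 0 2 := fun q => h (h02 q)
    have b : ¬ x.1.Reachable 1 2 := fun q => h (h12 q)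
    simp [Fin.forall_fin_succ, h, a, b, s 1 0, s 2 0, s 2 1]

theorem K4e_class {x : Σ h : SimpleGraph (Fin 4), SimpleGraph h.ConnectedComponent}
    (hx : IsGFactorization K4e x) :
    (∀ u v, x.1.Reachable u v ↔ u = v) ∨ (∀ u v, x.1.Reachable u v) ∨
    (∀ u v, x.1.Reachable u v ↔ (![0, 0, 1, 2] : Fin 4 → Fin 3) u = ![0, 0, 1, 2] v) ∨
    (∀ u v, x.1.Reachable u v ↔ (![0, 1, 0, 0] : Fin 4 → Fin 2) u = ![0, 1, 0, 0] v) ∨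
    (∀ u v, x.1.Reachable u v ↔ (![1, 0, 0, 0] : Fin 4 → Fin 2) u = ![1, 0, 0, 0] v) := by
  have s : ∀ u v, x.1.Reachable u v → x.1.Reachable v u := fun u v h => h.symm
  have r : ∀ u, x.1.Reachable u u := fun u => SimpleGraph.Reachable.refl u
  have m := fact_module hx
  have nb := fact_nbr hx
  have t : ∀ u v w, x.1.Reachable u v → x.1.Reachable v w → x.1.Reachable u w :=
    fun u v w h h' => h.trans h'
  have nb' : x.1.Reachable 2 3 → x.1.Reachable 2 0 ∨ x.1.Reachable 2 1 := by
    intro h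
    obtain ⟨w, h1, h2⟩ := nb 2 3 h (by decide)
    rw [K4e_adj] at h1
    have : w = 0 ∨ w = 1 := by clear h2; revert h1; revert w; decide
    rcases this with rfl | rfl
    · exact Or.inl h2
    · exact Or.inr h2
  have m0 : x.1.Reachable 0 2 → x.1.Reachable 0 3 := by
    intro h
    by_contra h2
    have := m 0 2 3 h h2 (by rw [K4e_adj]; decide)
    rw [K4e_adj] at this
    revert this; decide
  have m1 : x.1.Reachable 1 2 → x.1.Reachable 1 3 := by
    intro h
    by_contra h2
    have := m 1 2 3 h h2 (by rw [K4e_adj]; decide)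
    rw [K4e_adj] at this
    revert this; decide
  have m2 : x.1.Reachable 0 3 → x.1.Reachable 0 2 := by
    intro h
    by_contra h2
    have := m 0 3 2 h h2 (by rw [K4e_adj]; decide)
    rw [K4e_adj] at this
    revert this; decide
  have m3 : x.1.Reachable 1 3 → x.1.Reachable 1 2 := by
    intro h
    by_contra h2
    have := m 1 3 2 h h2 (by rw [K4e_adj]; decide)
    rw [K4e_adj] at this
    revert this; decide
  clear m nb
  generalize hR : x.1.Reachable = R at *
  have s' : ∀ u v, R u v ↔ R v u := fun u v => ⟨s u v, s v u⟩
  have e10 := s' 1 0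
  have e20 := s' 2 0
  have e30 := s' 3 0
  have e21 := s' 2 1
  have e31 := s' 3 1
  have e32 := s' 3 2
  have t012 := t 0 1 2
  have t102 := t 1 0 2
  have t021 := t 0 2 1
  have t023 := t 0 2 3
  have t123 := t 1 2 3
  have t203 := t 2 0 3
  have t213 := t 2 1 3
  by_cases h01 : R 0 1
  · by_cases h02 : R 0 2
    · right; left
      have h03 : R 0 3 := m0 h02
      have h12 : R 1 2 := t102 (e10.2 h01) h02
      have h13 : R 1 3 := m1 h12
      have h23 : R 2 3 := t203 (e20.2 h02) h03
      simp [Fin.forall_fin_succ, r, e10, e20, e30, e21, e31, e32, h01, h02, h03, h12, h13, h23]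
    · right; right; left
      have h03 : ¬ R 0 3 := fun h => h02 (m2 h)
      have h12 : ¬ R 1 2 := fun h => h02 (t012 h01 h)
      have h13 : ¬ R 1 3 := fun h => h12 (m3 h)
      have h23 : ¬ R 2 3 := fun h =>
        (nb' h).elim (fun a => h02 (e20.1 a)) (fun a => h12 (e21.1 a))
      simp [Fin.forall_fin_succ, r, e10, e20, e30, e21, e31, e32, h01, h02, h03, h12, h13, h23]
  · by_cases h02 : R 0 2
    · right; right; right; left
      have h03 : R 0 3 := m0 h02
      have h12 : ¬ R 1 2 := fun h => h01 (t021 h02 (e21.2 h))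
      have h13 : ¬ R 1 3 := fun h => h12 (m3 h)
      have h23 : R 2 3 := t203 (e20.2 h02) h03
      simp [Fin.forall_fin_succ, r, e10, e20, e30, e21, e31, e32, h01, h02, h03, h12, h13, h23]
    · have h03 : ¬ R 0 3 := fun h => h02 (m2 h)
      by_cases h12 : R 1 2
      · right; right; right; right
        have h13 : R 1 3 := m1 h12
        have h23 : R 2 3 := t213 (e21.2 h12) h13
        simp [Fin.forall_fin_succ, r, e10, e20, e30, e21, e31, e32, h01, h02, h03, h12, h13, h23]
      · left
        have h13 : ¬ R 1 3 := fun h => h12 (m3 h)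
        have h23 : ¬ R 2 3 := fun h =>
        (nb' h).elim (fun a => h02 (e20.1 a)) (fun a => h12 (e21.1 a))
        simp [Fin.forall_fin_succ, r, e10, e20, e30, e21, e31, e32, h01, h02, h03, h12, h13, h23]

/-- The explicit isomorphism between an induced subgraph and a given graph. -/
theorem tt_induce {n k : ℕ} (g : SimpleGraph (Fin n)) (s : Set (Fin n)) (q : Fin k → Fin n)
    (hq : Function.Injective q) (hs : ∀ v, v ∈ s ↔ ∃ i, q i = v) (H : SimpleGraph (Fin k))
    (hH : ∀ i j, H.Adj i j ↔ g.Adj (q i) (q j)) [Fintype s] :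
    tt (SimpleGraph.induce s g) = tt H := by
  refine (tt_congr ⟨Equiv.ofBijective (fun i => (⟨q i, (hs _).2 ⟨i, rfl⟩⟩ : s)) ⟨?_, ?_⟩, ?_⟩).symm
  · intro i j h
    exact hq (congrArg Subtype.val h)
  · rintro ⟨v, hv⟩
    obtain ⟨i, rfl⟩ := (hs v).1 hv
    exact ⟨i, rfl⟩
  · intro i j
    exact (hH i j).symm

theorem tt_induce_one {n : ℕ} (g : SimpleGraph (Fin n)) (s : Set (Fin n)) (a : Fin n)
    (hs : ∀ v, v ∈ s ↔ v = a) [Fintype s] :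
    tt (SimpleGraph.induce s g) = 1 := by
  apply tt_one
  have : Fintype.card s ≤ 1 := by
    rw [Fintype.card_le_one_iff]
    rintro ⟨u, hu⟩ ⟨v, hv⟩
    exact Subtype.ext (((hs u).1 hu).trans ((hs v).1 hv).symm)
  omega

/-- The antipode of the natural Hopf algebra of the graph operad on `K₄ − e`.
The antipode is the (unique) algebra endomorphism `S` satisfying the antipode
convolution identity `∑ S(t_{τ(a)})·t_{τ(g')} = 0` on every generator
`t_{τ(g)}` (`g` connected with at least two vertices); for it,
`S(t_{K₄−e}) = −t_{K₄−e} + 3 t_{P₃} t_{K₂}`. -/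
theorem antipode_K4_minus_e (S : RG →ₐ[ℚ] RG)
    (hS : ∀ (n : ℕ) (g : SimpleGraph (Fin n)), 2 ≤ n → g.Connected →
      ∑ x ∈ Finset.univ.filter (IsGFactorization g),
        S (∏ c : x.1.ConnectedComponent,
            tt (SimpleGraph.induce {v : Fin n | x.1.connectedComponentMk v = c} x.1))
          * tt x.2 = 0) :
    S (tt K4e) = - tt K4e + 3 * (tt P3 * tt K2) := by
  have hK2 := K2_prim S (hS 2 K2 le_rfl (conn_of_diam (by norm_num) K2_diam))
  have hP3 := P3_prim S (hS 3 P3 (by norm_num) (conn_of_diam (by norm_num) P3_diam))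
  have hg : K4e.Connected := conn_of_diam (by norm_num) K4e_diam
  have h := hS 4 K4e (by norm_num) hg
  obtain ⟨x0, hx0, r0, v0⟩ := fact_bot hg S
  obtain ⟨x1, hx1, r1, v1⟩ := fact_top hg S K4e_diam
  obtain ⟨x2, hx2, r2⟩ := fact_exists hg (![0, 0, 1, 2] : Fin 4 → Fin 3)
    (by simp only [K4e_adj]; decide) (by simp only [K4e_adj]; decide)
  obtain ⟨x3, hx3, r3⟩ := fact_exists hg (![0, 1, 0, 0] : Fin 4 → Fin 2)
    (by simp only [K4e_adj]; decide) (by simp only [K4e_adj]; decide)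
  obtain ⟨x4, hx4, r4⟩ := fact_exists hg (![1, 0, 0, 0] : Fin 4 → Fin 2)
    (by simp only [K4e_adj]; decide) (by simp only [K4e_adj]; decide)
  -- the path on {0,1}, 2, 3 with centre the block 0
  let Q : SimpleGraph (Fin 3) := P3.map (Equiv.swap (0 : Fin 3) 1).toEmbedding
  have hQ : tt Q = tt P3 := (tt_congr (SimpleGraph.Iso.map (Equiv.swap (0 : Fin 3) 1) P3)).symm
  have hQadj : ∀ i j, Q.Adj i j ↔ P3.Adj (Equiv.swap (0 : Fin 3) 1 i) (Equiv.swap (0 : Fin 3) 1 j) := by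
    intro i j
    have := (SimpleGraph.Iso.map (Equiv.swap (0 : Fin 3) 1) P3).map_adj_iff
      (v := Equiv.swap (0 : Fin 3) 1 i) (w := Equiv.swap (0 : Fin 3) 1 j)
    rw [← this]
    simp [Q]
  have v2 := fact_value hx2 _ r2 (by decide) Q
    (by simp only [hQadj, P3_adj, K4e_adj]; decide) S
  have v3 := fact_value hx3 _ r3 (by decide) K2
    (by simp only [K2_adj, K4e_adj]; decide) S
  have v4 := fact_value hx4 _ r4 (by decide) K2
    (by simp only [K2_adj, K4e_adj]; decide) S
  rw [Fin.prod_univ_three,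
    tt_induce K4e _ (![0, 1] : Fin 2 → Fin 4) (by decide)
      (by simp only [Set.mem_ofPred_eq]; decide) K2 (by simp only [K2_adj, K4e_adj]; decide),
    tt_induce_one K4e _ 2 (by simp only [Set.mem_ofPred_eq]; decide),
    tt_induce_one K4e _ 3 (by simp only [Set.mem_ofPred_eq]; decide), mul_one, mul_one, hQ, hK2] at v2
  rw [Fin.prod_univ_two,
    tt_induce K4e _ (![2, 0, 3] : Fin 3 → Fin 4) (by decide)
      (by simp only [Set.mem_ofPred_eq]; decide) P3 (by simp only [P3_adj, K4e_adj]; decide),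
    tt_induce_one K4e _ 1 (by simp only [Set.mem_ofPred_eq]; decide), mul_one, hP3] at v3
  rw [Fin.prod_univ_two,
    tt_induce K4e _ (![2, 1, 3] : Fin 3 → Fin 4) (by decide)
      (by simp only [Set.mem_ofPred_eq]; decide) P3 (by simp only [P3_adj, K4e_adj]; decide),
    tt_induce_one K4e _ 0 (by simp only [Set.mem_ofPred_eq]; decide), mul_one, hP3] at v4
  have hfil : Finset.univ.filter (IsGFactorization K4e) = {x0, x1, x2, x3, x4} := by
    ext z
    simp only [Finset.mem_filter, Finset.mem_univ, true_and, Finset.mem_insert,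
      Finset.mem_singleton]
    constructor
    · intro hz
      rcases K4e_class hz with h | h | h | h | h
      · exact Or.inl (fact_uniq hz hx0 fun u v => (h u v).trans (r0 u v).symm)
      · exact Or.inr (Or.inl (fact_uniq hz hx1 fun u v => ⟨fun _ => r1 u v, fun _ => h u v⟩))
      · exact Or.inr (Or.inr (Or.inl (fact_uniq hz hx2 fun u v => (h u v).trans (r2 u v).symm)))
      · exact Or.inr (Or.inr (Or.inr (Or.inl
          (fact_uniq hz hx3 fun u v => (h u v).trans (r3 u v).symm))))
      · exact Or.inr (Or.inr (Or.inr (Or.inr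
          (fact_uniq hz hx4 fun u v => (h u v).trans (r4 u v).symm))))
    · rintro (rfl | rfl | rfl | rfl | rfl) <;> assumption
  have n01 : x0 ≠ x1 := by
    rintro rfl
    exact absurd ((r0 0 1).1 (r1 0 1)) (by decide)
  have n02 : x0 ≠ x2 := by
    rintro rfl
    exact absurd ((r0 0 1).1 ((r2 0 1).2 (by decide))) (by decide)
  have n03 : x0 ≠ x3 := by
    rintro rfl
    exact absurd ((r0 0 2).1 ((r3 0 2).2 (by decide))) (by decide)
  have n04 : x0 ≠ x4 := by
    rintro rfl
    exact absurd ((r0 1 2).1 ((r4 1 2).2 (by decide))) (by decide)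
  have n12 : x1 ≠ x2 := by
    rintro rfl
    exact absurd ((r2 0 2).1 (r1 0 2)) (by decide)
  have n13 : x1 ≠ x3 := by
    rintro rfl
    exact absurd ((r3 0 1).1 (r1 0 1)) (by decide)
  have n14 : x1 ≠ x4 := by
    rintro rfl
    exact absurd ((r4 0 1).1 (r1 0 1)) (by decide)
  have n23 : x2 ≠ x3 := by
    rintro rfl
    exact absurd ((r2 0 2).1 ((r3 0 2).2 (by decide))) (by decide)
  have n24 : x2 ≠ x4 := by
    rintro rfl
    exact absurd ((r2 1 2).1 ((r4 1 2).2 (by decide))) (by decide)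
  have n34 : x3 ≠ x4 := by
    rintro rfl
    exact absurd ((r3 1 2).1 ((r4 1 2).2 (by decide))) (by decide)
  rw [hfil, Finset.sum_insert (by simp [n01, n02, n03, n04]),
    Finset.sum_insert (by simp [n12, n13, n14]), Finset.sum_insert (by simp [n23, n24]),
    Finset.sum_pair n34, v0, v1, v2, v3, v4] at h
  linear_combination h
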